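/- arXiv:2603.29714 — 3 statements merged into one kernel-verified Lean document; each statement's English description precedes it below -/
import Mathlib

section
/- For any x ∈ P, the nonnegatively graded part of the annihilator of I_P in *E_x equals S_x: (0 :_{*E_x} I_P)_{≥0} = S_x, where for a Z^n-graded module M, M_{≥0} := ⊕_{a ≥ 0} M_a (componentwise comparison in Z^n). Consequently [*Hom_S(A_P, *E_x)]_{≥0} ≅ S_x. -/
open scoped Classical
open MvPolynomial

noncomputable section

variable (K : Type) [Field K]
variable (P : Type) [Fintype P] [PartialOrder P] [OrderBot P]

/-- A finite poset with a least element is *simplicial* if every lower interval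
is isomorphic to a boolean algebra (the lattice of all subsets of a finite set). -/
def IsSimplicialPoset : Prop :=
  ∀ x : P, ∃ m : ℕ, Nonempty (Set.Iic x ≃o Finset (Fin m))

/-- `P* := P \ {0̂}`. -/
abbrev Pstar := {z : P // z ≠ ⊥}

/-- The polynomial ring `S = K[t_z : z ∈ P*]`. -/
abbrev FaceS := MvPolynomial (Pstar P) K

/-- The variable `t_z`, with the convention `t_{0̂} = 1`. -/
def tvar (z : P) : FaceS K P := if h : z = ⊥ then 1 else X ⟨z, h⟩

/-- The set `[a ∨ b]` of minimal elements of the common upper bounds of `a` and `b`. -/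
def minUB (a b : P) : Set P :=
  {z | a ≤ z ∧ b ≤ z ∧ ∀ w, a ≤ w → b ≤ w → ¬ w < z}

/-- Minimal elements of the common upper bounds of a set `A`. -/
def minUBset (A : Set P) : Set P :=
  {z | (∀ a ∈ A, a ≤ z) ∧ ∀ w, (∀ a ∈ A, a ≤ w) → ¬ w < z}

/-- The meet `a ∧ b`, i.e. the largest common lower bound, when it exists (`⊥` otherwise). -/
def pmeet (a b : P) : P :=
  if h : ∃ m, m ≤ a ∧ m ≤ b ∧ ∀ w, w ≤ a → w ≤ b → w ≤ m then h.choose else ⊥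

/-- The generator `f_{a,b} = t_a t_b - t_{a ∧ b} ∑_{z ∈ [a ∨ b]} t_z` of the face ideal. -/
def fgen (a b : Pstar P) : FaceS K P :=
  X a * X b - tvar K P (pmeet P a.1 b.1) *
    ∑ z ∈ (Set.toFinite (minUB P a.1 b.1)).toFinset, tvar K P z

/-- The face ideal `I_P`. -/
def faceIdeal : Ideal (FaceS K P) :=
  Ideal.span (Set.range fun p : Pstar P × Pstar P => fgen K P p.1 p.2)

variable (n : ℕ) (y : Fin n → P)

/-- `y` is an enumeration of the rank one elements (= atoms) of `P`. -/
def AtomEnum : Prop :=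
  Function.Injective y ∧ ∀ p : P, IsAtom p ↔ ∃ i, y i = p

/-- The rank of an element: the number of atoms below it. -/
def prank (z : P) : ℕ := (Finset.univ.filter fun i : Fin n => y i ≤ z).card

/-- The `ℤⁿ`-degree of the variable `t_z`: `deg t_z = ∑_{y_i ≤ z} e_i`. -/
def tdeg (z : Pstar P) : Fin n → ℤ := fun i => if y i ≤ z.1 then 1 else 0

/-- `w = ∑_{z ∈ P*} deg t_z`. -/
def wvec : Fin n → ℤ := fun i => ∑ z : Pstar P, tdeg P n y z i

/-- The degree `d` homogeneous component of `S` for the `ℤⁿ`-grading. -/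
def Sgrade (d : Fin n → ℤ) : AddSubgroup (FaceS K P) :=
  (weightedHomogeneousSubmodule K (tdeg P n y) d).toAddSubgroup

/-- The transformed variable `t̃_z` (relative to `x`), with `t̃_{0̂} = 1`. -/
def ttil (x z : P) : FaceS K P :=
  if z ≤ x ∧ 2 ≤ prank P n y z then
    tvar K P z - ∏ i ∈ Finset.univ.filter fun i : Fin n => y i ≤ z, tvar K P (y i)
  else tvar K P z

/-- The graded prime ideal `p_x = (t_z : z ≰ x) + I_P`. -/
def pIdeal (x : P) : Ideal (FaceS K P) :=
  Ideal.span ((fun z : Pstar P => (X z : FaceS K P)) '' {z | ¬ z.1 ≤ x}) ⊔ faceIdeal K P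

/-- The indices of the atoms below `x`. -/
abbrev BelowIx (x : P) := {i : Fin n // y i ≤ x}

/-- `P*_{-x}`: the elements of `P*` which are not atoms below `x`. -/
abbrev Pmx (x : P) := {z : P // z ≠ ⊥ ∧ ¬ ∃ i : Fin n, y i ≤ x ∧ y i = z}

/-- Index monoid for the "big Laurent" model of `*E_x`. -/
abbrev EIdx (x : P) := (BelowIx P n y x →₀ ℤ) × (Pmx P n y x →₀ ℤ)

/-- The "big Laurent" algebra `K[t_i^{±1} : y_i ≤ x] ⊗_K K[t̃_z^{±1} : z ∈ P*_{-x}]`. -/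
abbrev Gx (x : P) := AddMonoidAlgebra K (EIdx P n y x)

/-- Exponent vector of `π_x(t_z) = ∏_{y_i ≤ z} t_i`. -/
def dvec (x : P) (z : P) : BelowIx P n y x →₀ ℤ :=
  Finsupp.equivFunOnFinite.symm fun i => if y i.1 ≤ z then 1 else 0

/-- The action of `S` on the big Laurent algebra through the comultiplication
`Δ(t_z) = t_z ⊗ 1 + 1 ⊗ t_z`:  the variable `t_z` acts as `π_x(t_z) ⊗ 1 + 1 ⊗ t_z`. -/
def theta (x : P) : FaceS K P →ₐ[K] Gx K P n y x :=
  aeval fun z : Pstar P =>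
    (if z.1 ≤ x then AddMonoidAlgebra.single (dvec P n y x z.1, 0) 1 else 0) +
    (if h : ∃ i : Fin n, y i ≤ x ∧ y i = z.1 then 0
     else AddMonoidAlgebra.single
       ((0 : BelowIx P n y x →₀ ℤ), Finsupp.single (⟨z.1, z.2, h⟩ : Pmx P n y x) (1 : ℤ)) 1)

instance gxModule (x : P) : Module (FaceS K P) (Gx K P n y x) :=
  Module.compHom _ (theta K P n y x).toRingHom

instance gxTower (x : P) : IsScalarTower K (FaceS K P) (Gx K P n y x) := by
  refine ⟨fun k s g => ?_⟩
  show theta K P n y x (k • s) * g = k • (theta K P n y x s * g)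
  rw [map_smul, smul_mul_assoc]

instance gxComm (x : P) : SMulCommClass (FaceS K P) K (Gx K P n y x) := by
  refine ⟨fun s k g => ?_⟩
  show theta K P n y x s * (k • g) = k • (theta K P n y x s * g)
  exact mul_smul_comm k _ g

/-- The submodule by which we quotient the big Laurent algebra to obtain `*E_x`. -/
def Ux (x : P) : Submodule (FaceS K P) (Gx K P n y x) :=
  Submodule.span (FaceS K P)
    {g | ∃ p : EIdx P n y x, (∃ w, 0 < p.2 w) ∧ g = AddMonoidAlgebra.single p 1}

/-- The `ℤⁿ`-graded `S`-module `*E_x = K[t_i^{±1} : y_i ≤ x] ⊗_K K[t_z^{-1} : z ∈ P*_{-x}]`. -/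
abbrev ExMod (x : P) := Gx K P n y x ⧸ Ux K P n y x

instance exComm (x : P) : SMulCommClass (FaceS K P) K (ExMod K P n y x) := by
  refine ⟨fun s k e => ?_⟩
  obtain ⟨g, rfl⟩ := Submodule.Quotient.mk_surjective _ e
  simp only [← Submodule.Quotient.mk_smul]
  rw [smul_comm]

def mIdx (x : P) (a : BelowIx P n y x →₀ ℤ) (b : Pmx P n y x →₀ ℕ) : EIdx P n y x :=
  (a, -Finsupp.mapRange (Nat.cast : ℕ → ℤ) Nat.cast_zero b)

/-- The monomial `∏ t_i^{a_i} ⊗ ∏ t_z^{-b_z}` of `*E_x`. -/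
def emono (x : P) (a : BelowIx P n y x →₀ ℤ) (b : Pmx P n y x →₀ ℕ) : ExMod K P n y x :=
  Submodule.Quotient.mk (AddMonoidAlgebra.single (mIdx P n y x a b) 1)

/-- `1_x = 1 ⊗ 1 ∈ *E_x`. -/
def onex (x : P) : ExMod K P n y x := emono K P n y x 0 0

/-- The `ℤⁿ`-degree of the monomial of `*E_x` with index `p`. -/
def gdeg (x : P) (p : EIdx P n y x) : Fin n → ℤ := fun i =>
  (if h : y i ≤ x then p.1 ⟨i, h⟩ else 0) +
    p.2.sum fun w c => c * (if y i ≤ w.1 then 1 else 0)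

/-- The degree `aa` homogeneous component of `*E_x`. -/
def ExGrade (x : P) (aa : Fin n → ℤ) : Submodule K (ExMod K P n y x) :=
  Submodule.span K
    {e | ∃ p : EIdx P n y x, gdeg P n y x p = aa ∧
      e = Submodule.Quotient.mk (AddMonoidAlgebra.single p 1)}

/-- `L(*E_x)`: the span of the basis monomials with nontrivial second factor and
componentwise nonnegative `ℤⁿ`-degree. -/
def cleanL (x : P) : Submodule K (ExMod K P n y x) :=
  Submodule.span K
    {e | ∃ a b, b ≠ 0 ∧ (∀ i, 0 ≤ gdeg P n y x (mIdx P n y x a b) i) ∧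
      e = emono K P n y x a b}

/-- Degree preserving homomorphisms `*E_x → *E_z` (elements of `[*Hom(E_x, E_z)]_0`). -/
def DegZero (x z : P) (φ : ExMod K P n y x →ₗ[FaceS K P] ExMod K P n y z) : Prop :=
  ∀ aa, ∀ e ∈ ExGrade K P n y x aa, φ e ∈ ExGrade K P n y z aa

/-- Clean homomorphisms `*E_x → *E_z`. -/
def IsClean (x z : P) (φ : ExMod K P n y x →ₗ[FaceS K P] ExMod K P n y z) : Prop :=
  DegZero K P n y x z φ ∧ ∀ e ∈ cleanL K P n y x, φ e ∈ cleanL K P n y z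


set_option linter.unusedSectionVars false

section SimplicialPoset

variable {P n}

/-- The indices of the atoms below `z`. -/
def atomsBelow (z : P) : Finset (Fin n) := Finset.univ.filter fun i => y i ≤ z

variable {y}

@[simp]
lemma mem_atomsBelow {z : P} {i : Fin n} : i ∈ atomsBelow y z ↔ y i ≤ z := by
  simp [atomsBelow]

lemma atomsBelow_mono {z w : P} (h : z ≤ w) : atomsBelow y z ⊆ atomsBelow y w := by
  intro i hi
  rw [mem_atomsBelow] at *
  exact hi.trans h

lemma AtomEnum.isAtom (hy : AtomEnum P n y) (i : Fin n) : IsAtom (y i) :=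
  (hy.2 _).2 ⟨i, rfl⟩

lemma AtomEnum.le_iff_eq (hy : AtomEnum P n y) {i j : Fin n} : y i ≤ y j ↔ i = j := by
  refine ⟨fun h => hy.1 ?_, fun h => h ▸ le_rfl⟩
  exact ((hy.isAtom j).le_iff.1 h).resolve_left (hy.isAtom i).1

lemma AtomEnum.atomsBelow_bot (hy : AtomEnum P n y) : atomsBelow y (⊥ : P) = ∅ := by
  ext i
  simp [(hy.isAtom i).1]

lemma AtomEnum.atomsBelow_atom (hy : AtomEnum P n y) (i : Fin n) :
    atomsBelow y (y i) = {i} := by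
  ext j
  simp [hy.le_iff_eq]

/-- Below a fixed element, the order is inclusion of sets of atoms. -/
lemma IsSimplicialPoset.le_of_atomsBelow_subset (hP : IsSimplicialPoset P)
    (hy : AtomEnum P n y) {x z w : P} (hz : z ≤ x) (hw : w ≤ x)
    (h : atomsBelow y z ⊆ atomsBelow y w) : z ≤ w := by
  obtain ⟨m, ⟨e⟩⟩ := hP x
  change (⟨z, hz⟩ : Set.Iic x) ≤ ⟨w, hw⟩
  rw [← e.le_iff_le]
  intro j hj
  have hatom : IsAtom (e.symm {j}) := (e.symm.isAtom_iff _).2 (Finset.isAtom_singleton j)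
  obtain ⟨i, hi⟩ := (hy.2 _).1 hatom.of_isAtom_coe_Iic
  have hjz : e.symm {j} ≤ ⟨z, hz⟩ := by
    rw [e.symm_apply_le]
    simpa using hj
  have hiw : y i ≤ w := mem_atomsBelow.1 (h (mem_atomsBelow.2 (hi ▸ hjz)))
  have hjw : e.symm {j} ≤ ⟨w, hw⟩ := by
    change ((e.symm {j} : Set.Iic x) : P) ≤ w
    exact hi ▸ hiw
  rw [e.symm_apply_le] at hjw
  simpa using hjw

lemma IsSimplicialPoset.eq_of_atomsBelow_eq (hP : IsSimplicialPoset P)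
    (hy : AtomEnum P n y) {x z w : P} (hz : z ≤ x) (hw : w ≤ x)
    (h : atomsBelow y z = atomsBelow y w) : z = w :=
  le_antisymm (hP.le_of_atomsBelow_subset hy hz hw h.subset)
    (hP.le_of_atomsBelow_subset hy hw hz h.superset)

/-- Every set of atoms below `x` is the set of atoms of some element below `x`. -/
lemma IsSimplicialPoset.exists_atomsBelow_eq (hP : IsSimplicialPoset P)
    (hy : AtomEnum P n y) {x : P} {B : Finset (Fin n)} (hB : B ⊆ atomsBelow y x) :
    ∃ z ≤ x, atomsBelow y z = B := by
  obtain ⟨m, ⟨e⟩⟩ := hP x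
  have hsingle (i : Fin n) (hi : y i ≤ x) : ∃ j, e ⟨y i, hi⟩ = {j} := by
    rw [← Finset.isAtom_iff, e.isAtom_iff]
    exact (hy.isAtom i).Iic hi
  refine ⟨e.symm (Finset.univ.filter fun j => ∃ i ∈ B, y i = e.symm {j}), (e.symm _).2, ?_⟩
  ext i
  rw [mem_atomsBelow]
  constructor
  · intro hi
    have hix : y i ≤ x := hi.trans (e.symm _).2
    obtain ⟨j, hj⟩ := hsingle i hix
    have hle : (⟨y i, hix⟩ : Set.Iic x) ≤
      e.symm (Finset.univ.filter fun j => ∃ i ∈ B, y i = e.symm {j}) := hi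
    rw [e.le_symm_apply, hj] at hle
    obtain ⟨k, hk, hkj⟩ := by simpa using hle
    rw [← hj, e.symm_apply_apply] at hkj
    exact hy.1 hkj ▸ hk
  · intro hi
    have hix : y i ≤ x := mem_atomsBelow.1 (hB hi)
    obtain ⟨j, hj⟩ := hsingle i hix
    change (⟨y i, hix⟩ : Set.Iic x) ≤ _
    rw [e.le_symm_apply, hj]
    have hyi : y i = (e.symm {j} : Set.Iic x) := by rw [← hj, e.symm_apply_apply]
    simpa using ⟨i, hi, hyi⟩

lemma pmeet_le_left {a b : P} : pmeet P a b ≤ a := by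
  unfold pmeet
  split_ifs with h
  · exact h.choose_spec.1
  · exact bot_le

lemma IsSimplicialPoset.atomsBelow_pmeet (hP : IsSimplicialPoset P)
    (hy : AtomEnum P n y) {x a b : P} (ha : a ≤ x) (hb : b ≤ x) :
    atomsBelow y (pmeet P a b) = atomsBelow y a ∩ atomsBelow y b := by
  have hex : ∃ m, m ≤ a ∧ m ≤ b ∧ ∀ w, w ≤ a → w ≤ b → w ≤ m := by
    obtain ⟨m, hm, hmB⟩ := hP.exists_atomsBelow_eq hy
      (Finset.inter_subset_left.trans (atomsBelow_mono ha) :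
        atomsBelow y a ∩ atomsBelow y b ⊆ atomsBelow y x)
    refine ⟨m, hP.le_of_atomsBelow_subset hy hm ha (hmB.trans_subset Finset.inter_subset_left),
      hP.le_of_atomsBelow_subset hy hm hb (hmB.trans_subset Finset.inter_subset_right),
      fun w hwa hwb => hP.le_of_atomsBelow_subset hy (hwa.trans ha) hm ?_⟩
    rw [hmB]
    exact Finset.subset_inter (atomsBelow_mono hwa) (atomsBelow_mono hwb)
  obtain ⟨h₁, h₂, h₃⟩ := hex.choose_spec
  rw [pmeet, dif_pos hex]
  refine (Finset.subset_inter (atomsBelow_mono h₁) (atomsBelow_mono h₂)).antisymm fun i hi => ?_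
  simp only [Finset.mem_inter, mem_atomsBelow] at hi ⊢
  exact h₃ _ hi.1 hi.2

/-- The elements of `[a ∨ b]` are the common upper bounds without extra atoms. -/
lemma IsSimplicialPoset.mem_minUB_iff (hP : IsSimplicialPoset P)
    (hy : AtomEnum P n y) {a b v : P} :
    v ∈ minUB P a b ↔ a ≤ v ∧ b ≤ v ∧ atomsBelow y v = atomsBelow y a ∪ atomsBelow y b := by
  constructor
  · rintro ⟨ha, hb, hmin⟩
    obtain ⟨j, hj, hjB⟩ := hP.exists_atomsBelow_eq hy
      (Finset.union_subset (atomsBelow_mono ha) (atomsBelow_mono hb))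
    have haj := hP.le_of_atomsBelow_subset hy ha hj (Finset.subset_union_left.trans hjB.superset)
    have hbj := hP.le_of_atomsBelow_subset hy hb hj (Finset.subset_union_right.trans hjB.superset)
    have hjv : j = v := hj.eq_of_not_lt (hmin j haj hbj)
    exact ⟨ha, hb, hjv ▸ hjB⟩
  · rintro ⟨ha, hb, hv⟩
    refine ⟨ha, hb, fun w haw hbw hwv => hwv.not_ge ?_⟩
    refine hP.le_of_atomsBelow_subset hy le_rfl hwv.le ?_
    rw [hv]
    exact Finset.union_subset (atomsBelow_mono haw) (atomsBelow_mono hbw)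

/-- Two elements below `x` have exactly one minimal common upper bound below `x`. -/
lemma IsSimplicialPoset.exists_mem_minUB (hP : IsSimplicialPoset P)
    (hy : AtomEnum P n y) {x a b : P} (ha : a ≤ x) (hb : b ≤ x) :
    ∃ j ∈ minUB P a b, j ≤ x ∧ ∀ v ∈ minUB P a b, v ≤ x → v = j := by
  obtain ⟨j, hj, hjB⟩ := hP.exists_atomsBelow_eq hy
    (Finset.union_subset (atomsBelow_mono ha) (atomsBelow_mono hb))
  refine ⟨j, (hP.mem_minUB_iff hy).2 ⟨?_, ?_, hjB⟩, hj, fun v hv hvx => ?_⟩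
  · exact hP.le_of_atomsBelow_subset hy ha hj (Finset.subset_union_left.trans hjB.superset)
  · exact hP.le_of_atomsBelow_subset hy hb hj (Finset.subset_union_right.trans hjB.superset)
  · exact hP.eq_of_atomsBelow_eq hy hvx hj (((hP.mem_minUB_iff hy).1 hv).2.2.trans hjB.symm)

/-- If all atoms below `v` are below `x` but `v ≰ x`, then `[v ∨ x] = ∅`. -/
lemma IsSimplicialPoset.minUB_eq_empty (hP : IsSimplicialPoset P)
    (hy : AtomEnum P n y) {x v : P} (hv : ¬ v ≤ x) (h : atomsBelow y v ⊆ atomsBelow y x) :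
    minUB P v x = ∅ := by
  by_contra hne
  obtain ⟨w, hvw, hxw, -⟩ := Set.nonempty_iff_ne_empty.2 hne
  exact hv (hP.le_of_atomsBelow_subset hy hvw hxw h)

lemma IsSimplicialPoset.eq_bot_of_atomsBelow_eq_empty (hP : IsSimplicialPoset P)
    (hy : AtomEnum P n y) {z : P} (hz : atomsBelow y z = ∅) : z = ⊥ :=
  hP.eq_of_atomsBelow_eq hy le_rfl bot_le (hz.trans hy.atomsBelow_bot.symm)

end SimplicialPoset

section FaceIdeal

variable {K P n y}

@[simp]
lemma tvar_bot : tvar K P ⊥ = 1 := dif_pos rfl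

lemma tvar_of_ne {z : P} (hz : z ≠ ⊥) : tvar K P z = X ⟨z, hz⟩ := dif_neg hz

lemma tvar_mul_tvar_sub_mem_faceIdeal {a b : P} (ha : a ≠ ⊥) (hb : b ≠ ⊥) :
    tvar K P a * tvar K P b - tvar K P (pmeet P a b) *
      ∑ z ∈ (Set.toFinite (minUB P a b)).toFinset, tvar K P z ∈ faceIdeal K P := by
  rw [tvar_of_ne ha, tvar_of_ne hb]
  exact Ideal.subset_span ⟨(⟨a, ha⟩, ⟨b, hb⟩), rfl⟩

lemma tvar_mem_pIdeal {x z : P} (hz : ¬ z ≤ x) : tvar K P z ∈ pIdeal K P x := by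
  have hz0 : z ≠ ⊥ := fun h => hz (h ▸ bot_le)
  rw [tvar_of_ne hz0]
  exact Ideal.mem_sup_left (Ideal.subset_span ⟨⟨z, hz0⟩, hz, rfl⟩)

/-- If `v ≰ x` but all atoms below `v` are below `x`, then `t_v t_x ∈ I_P`. -/
lemma tvar_mul_tvar_mem_faceIdeal (hP : IsSimplicialPoset P) (hy : AtomEnum P n y) {x v : P}
    (hv : ¬ v ≤ x) (h : atomsBelow y v ⊆ atomsBelow y x) :
    tvar K P v * tvar K P x ∈ faceIdeal K P := by
  have hv0 : v ≠ ⊥ := fun h => hv (h ▸ bot_le)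
  have hx0 : x ≠ ⊥ := by
    rintro rfl
    rw [hy.atomsBelow_bot, Finset.subset_empty] at h
    exact hv0 (hP.eq_bot_of_atomsBelow_eq_empty hy h)
  simpa [hP.minUB_eq_empty hy hv h] using tvar_mul_tvar_sub_mem_faceIdeal (K := K) hv0 hx0

/-- Modulo an ideal containing `I_P` and all `t_v` with `v ≰ x`, each `t_z` with `z ≤ x` is the
product of the variables of the atoms below `z`. -/
lemma tvar_sub_prod_mem (hP : IsSimplicialPoset P) (hy : AtomEnum P n y) {x : P}
    {J : Ideal (FaceS K P)} (hJ : faceIdeal K P ≤ J) (hJx : ∀ v, ¬ v ≤ x → tvar K P v ∈ J)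
    (z : P) (hz : z ≤ x) :
    tvar K P z - ∏ i ∈ atomsBelow y z, tvar K P (y i) ∈ J := by
  induction z using WellFoundedLT.induction with
  | ind z ih =>
  obtain h0 | ⟨i, hi⟩ := (atomsBelow y z).eq_empty_or_nonempty
  · simp [hP.eq_bot_of_atomsBelow_eq_empty hy h0, hy.atomsBelow_bot]
  obtain ⟨u, huz, hu⟩ := hP.exists_atomsBelow_eq hy ((atomsBelow y z).erase_subset i)
  have hiz : y i ≤ z := mem_atomsBelow.1 hi
  by_cases hu0 : u = ⊥
  · have hzi : atomsBelow y z = {i} := by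
      rw [hu0, hy.atomsBelow_bot] at hu
      rw [← Finset.insert_erase hi, ← hu, LawfulSingleton.insert_empty_eq]
    have : z = y i := hP.eq_of_atomsBelow_eq hy le_rfl hiz (by rw [hzi, hy.atomsBelow_atom])
    rw [this]
    simp [hy.atomsBelow_atom]
  have hmeet : pmeet P (y i) u = ⊥ := by
    refine hP.eq_bot_of_atomsBelow_eq_empty hy ?_
    rw [hP.atomsBelow_pmeet hy hiz huz, hu, hy.atomsBelow_atom]
    simp
  have hzmem : z ∈ minUB P (y i) u := by
    rw [hP.mem_minUB_iff hy, hu, hy.atomsBelow_atom]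
    exact ⟨hiz, huz, by rw [← Finset.insert_eq, Finset.insert_erase hi]⟩
  obtain ⟨j, -, -, hj⟩ := hP.exists_mem_minUB hy (hiz.trans hz) (huz.trans hz)
  have hf := hJ (tvar_mul_tvar_sub_mem_faceIdeal (K := K) (hy.isAtom i).1 hu0)
  rw [hmeet, tvar_bot, one_mul,
    ← Finset.add_sum_erase _ _ ((Set.toFinite _).mem_toFinset.2 hzmem)] at hf
  have hrest : ∑ v ∈ (Set.toFinite (minUB P (y i) u)).toFinset.erase z, tvar K P v ∈ J := by
    refine J.sum_mem fun v hv => hJx v fun hvx => ?_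
    simp only [Finset.mem_erase, Set.Finite.mem_toFinset] at hv
    exact hv.1 ((hj v hv.2 hvx).trans (hj z hzmem hz).symm)
  have hui : u < z := by
    refine huz.lt_of_ne fun h => ?_
    rw [h] at hu
    exact absurd hi (hu ▸ Finset.notMem_erase i _)
  have hih := J.mul_mem_left (tvar K P (y i)) (ih u hui (huz.trans hz))
  rw [← Finset.mul_prod_erase _ _ hi, ← hu]
  convert J.sub_mem hih (J.add_mem hf hrest) using 1
  ring

end FaceIdeal

section Coefficients

variable {K P n y} {x : P}

lemma smul_gx_def (s : FaceS K P) (g : Gx K P n y x) : s • g = theta K P n y x s * g := rfl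

lemma coeff_X_smul (z : Pstar P) (g : Gx K P n y x) (p : EIdx P n y x) :
    ((X z : FaceS K P) • g).coeff p =
      (if z.1 ≤ x then g.coeff (p - (dvec P n y x z.1, 0)) else 0) +
      (if h : ∃ i : Fin n, y i ≤ x ∧ y i = z.1 then 0
        else g.coeff (p - (0, Finsupp.single (⟨z.1, z.2, h⟩ : Pmx P n y x) (1 : ℤ)))) := by
  rw [smul_gx_def, theta, aeval_X, add_mul, AddMonoidAlgebra.coeff_add, Finsupp.add_apply]
  congr 1
  · split_ifs
    · rw [AddMonoidAlgebra.coeff_single_mul_apply, one_mul, neg_add_eq_sub]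
    · simp
  · split_ifs
    · simp
    · rw [AddMonoidAlgebra.coeff_single_mul_apply, one_mul, neg_add_eq_sub]

lemma nonpos_sub_single {b : Pmx P n y x →₀ ℤ} (hb : b ≤ 0) (w : Pmx P n y x) :
    b - Finsupp.single w 1 ≤ 0 :=
  (sub_le_self _ (Finsupp.single_nonneg.2 zero_le_one)).trans hb

/-- `U_x` consists of the elements all of whose monomials have a positive exponent in the second
factor. -/
lemma mem_Ux_iff {g : Gx K P n y x} :
    g ∈ Ux K P n y x ↔ ∀ p : EIdx P n y x, p.2 ≤ 0 → g.coeff p = 0 := by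
  constructor
  · intro hg
    induction hg using Submodule.span_induction with
    | mem g hg =>
      obtain ⟨q, ⟨w, hw⟩, rfl⟩ := hg
      intro p hp
      rw [AddMonoidAlgebra.coeff_single, Finsupp.single_apply, if_neg]
      rintro rfl
      exact (hp w).not_gt hw
    | zero => simp
    | add g g' _ _ hg hg' =>
      intro p hp
      simp [hg p hp, hg' p hp]
    | smul s g _ hg =>
      induction s using MvPolynomial.induction_on with
      | C c =>
        intro p hp
        rw [smul_gx_def, ← MvPolynomial.algebraMap_eq, AlgHom.commutes, ← Algebra.smul_def]
        simp [hg p hp]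
      | add s s' hs hs' =>
        intro p hp
        simp [add_smul, hs p hp, hs' p hp]
      | mul_X s z hs =>
        intro p hp
        rw [mul_comm, mul_smul, coeff_X_smul]
        have h₁ := hs (p - (dvec P n y x z.1, 0)) (by simpa using hp)
        split_ifs <;> simp only [h₁, add_zero, zero_add] <;>
          exact hs _ (by simpa using nonpos_sub_single hp _)
  · intro hg
    rw [← AddMonoidAlgebra.sum_coeff_single g]
    refine Submodule.sum_mem _ fun p hp => ?_
    have : ¬ p.2 ≤ 0 := fun h => (Finsupp.mem_support_iff.1 hp) (hg p h)
    have hw : ∃ w, 0 < p.2 w := by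
      rw [Finsupp.le_def] at this
      push Not at this
      exact this
    rw [← mul_one (g.coeff p), ← smul_eq_mul, ← AddMonoidAlgebra.smul_single]
    exact Submodule.smul_of_tower_mem _ _ (Submodule.subset_span ⟨p, hw, rfl⟩)

lemma mk_eq_zero_iff {g : Gx K P n y x} :
    (Submodule.Quotient.mk g : ExMod K P n y x) = 0 ↔
      ∀ p : EIdx P n y x, p.2 ≤ 0 → g.coeff p = 0 := by
  rw [Submodule.Quotient.mk_eq_zero, mem_Ux_iff]

end Coefficients

section SpanOne

variable {K P n y} {x : P}

lemma dvec_apply (z : P) (i : BelowIx P n y x) :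
    dvec P n y x z i = if y i.1 ≤ z then 1 else 0 := rfl

lemma AtomEnum.dvec_bot (hy : AtomEnum P n y) : dvec P n y x ⊥ = 0 := by
  ext i
  simp [dvec_apply, (hy.isAtom i.1).1]

lemma IsSimplicialPoset.dvec_add_dvec (hP : IsSimplicialPoset P) (hy : AtomEnum P n y)
    {a b j : P} (ha : a ≤ x) (hb : b ≤ x) (hj : j ∈ minUB P a b) :
    dvec P n y x a + dvec P n y x b = dvec P n y x (pmeet P a b) + dvec P n y x j := by
  ext i
  have h₁ : y i.1 ≤ pmeet P a b ↔ y i.1 ≤ a ∧ y i.1 ≤ b := by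
    simp only [← mem_atomsBelow (y := y), hP.atomsBelow_pmeet hy ha hb, Finset.mem_inter]
  have h₂ : y i.1 ≤ j ↔ y i.1 ≤ a ∨ y i.1 ≤ b := by
    simp only [← mem_atomsBelow (y := y), ((hP.mem_minUB_iff hy).1 hj).2.2, Finset.mem_union]
  simp only [Finsupp.add_apply, dvec_apply, h₁, h₂]
  by_cases hia : y i.1 ≤ a <;> by_cases hib : y i.1 ≤ b <;> simp [hia, hib]

lemma theta_tvar_atom (hy : AtomEnum P n y) {i : Fin n} (hi : y i ≤ x) :
    theta K P n y x (tvar K P (y i)) = AddMonoidAlgebra.single (dvec P n y x (y i), 0) 1 := by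
  rw [tvar_of_ne (hy.isAtom i).1, theta, aeval_X, if_pos hi, dif_pos ⟨i, hi, rfl⟩, add_zero]

lemma theta_prod_atomsBelow (hy : AtomEnum P n y) {z : P} (hz : z ≤ x) :
    theta K P n y x (∏ i ∈ atomsBelow y z, tvar K P (y i)) =
      AddMonoidAlgebra.single (dvec P n y x z, 0) 1 := by
  rw [map_prod, Finset.prod_congr rfl fun i hi =>
    theta_tvar_atom hy ((mem_atomsBelow.1 hi).trans hz), AddMonoidAlgebra.prod_single,
    Finset.prod_const_one]
  congr 1
  refine Prod.ext ?_ (by simp [Prod.snd_sum])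
  ext i
  simp [Prod.fst_sum, Finsupp.finsetSum_apply, dvec_apply, hy.le_iff_eq]

/-- Modulo `U_x`, multiplication by `t_z` on `K[t_i^{±1}] ⊗ 1` is multiplication by `π_x(t_z)`. -/
lemma tvar_smul_mk_single (hy : AtomEnum P n y) (z : P) (a : BelowIx P n y x →₀ ℤ) :
    tvar K P z • (Submodule.Quotient.mk (AddMonoidAlgebra.single (a, 0) 1) : ExMod K P n y x) =
      if z ≤ x then Submodule.Quotient.mk (AddMonoidAlgebra.single (a + dvec P n y x z, 0) 1)
      else 0 := by
  by_cases hz : z = ⊥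
  · subst hz
    simp [hy.dvec_bot]
  have hpos (w : Pmx P n y x) : (Submodule.Quotient.mk (AddMonoidAlgebra.single
      ((0 : BelowIx P n y x →₀ ℤ), Finsupp.single w (1 : ℤ)) 1 *
        AddMonoidAlgebra.single (a, 0) 1) : ExMod K P n y x) = 0 := by
    rw [Submodule.Quotient.mk_eq_zero, AddMonoidAlgebra.single_mul_single, mul_one]
    exact Submodule.subset_span ⟨_, ⟨w, by simp⟩, rfl⟩
  rw [tvar_of_ne hz, ← Submodule.Quotient.mk_smul, smul_gx_def, theta, aeval_X, add_mul,
    Submodule.Quotient.mk_add]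
  have hsnd : (Submodule.Quotient.mk ((if h : ∃ i : Fin n, y i ≤ x ∧ y i = z then 0
      else AddMonoidAlgebra.single ((0 : BelowIx P n y x →₀ ℤ),
        Finsupp.single (⟨z, hz, h⟩ : Pmx P n y x) (1 : ℤ)) 1) *
      AddMonoidAlgebra.single (a, 0) 1) : ExMod K P n y x) = 0 := by
    split_ifs with h
    · simp
    · exact hpos _
  rw [hsnd, add_zero]
  split_ifs with hzx
  · rw [AddMonoidAlgebra.single_mul_single, mul_one, Prod.mk_add_mk, add_zero, add_comm]
  · simp

lemma onex_eq_mk :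
    onex K P n y x = Submodule.Quotient.mk (AddMonoidAlgebra.single (0, 0) 1) := by
  simp [onex, emono, mIdx]

lemma fgen_smul_onex (hP : IsSimplicialPoset P) (hy : AtomEnum P n y) (a b : Pstar P) :
    fgen K P a b • onex K P n y x = 0 := by
  rw [fgen, ← tvar_of_ne a.2, ← tvar_of_ne b.2, sub_smul, mul_smul, mul_smul, Finset.sum_smul,
    sub_eq_zero, onex_eq_mk]
  simp only [tvar_smul_mk_single hy, zero_add]
  by_cases hab : a.1 ≤ x ∧ b.1 ≤ x
  · obtain ⟨ha, hb⟩ := hab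
    obtain ⟨j, hj, hjx, huniq⟩ := hP.exists_mem_minUB hy ha hb
    have hmeet : pmeet P a.1 b.1 ≤ x := pmeet_le_left.trans ha
    rw [Finset.sum_eq_single_of_mem j ((Set.toFinite _).mem_toFinset.2 hj)
      fun v hv hvj => if_neg fun hvx => hvj (huniq v ((Set.toFinite _).mem_toFinset.1 hv) hvx)]
    rw [if_pos hb, if_pos hjx, tvar_smul_mk_single hy, tvar_smul_mk_single hy, if_pos ha,
      if_pos hmeet, add_comm (dvec P n y x b.1), hP.dvec_add_dvec hy ha hb hj, add_comm]
  · rw [Finset.sum_eq_zero, smul_zero]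
    · by_cases hb : b.1 ≤ x
      · rw [if_pos hb, tvar_smul_mk_single hy, if_neg fun ha => hab ⟨ha, hb⟩]
      · rw [if_neg hb, smul_zero]
    · intro v hv
      have hv' := (Set.toFinite _).mem_toFinset.1 hv
      exact if_neg fun hvx => hab ⟨hv'.1.trans hvx, hv'.2.1.trans hvx⟩

lemma pIdeal_le_torsionOf (hP : IsSimplicialPoset P) (hy : AtomEnum P n y) :
    pIdeal K P x ≤ Ideal.torsionOf (FaceS K P) (ExMod K P n y x) (onex K P n y x) := by
  refine sup_le (Ideal.span_le.2 ?_) (Ideal.span_le.2 ?_)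
  · rintro _ ⟨z, hz, rfl⟩
    change (X z : FaceS K P) • onex K P n y x = 0
    rw [← tvar_of_ne z.2, onex_eq_mk, tvar_smul_mk_single hy, if_neg hz]
  · rintro _ ⟨⟨a, b⟩, rfl⟩
    exact fgen_smul_onex hP hy a b

/-- The inclusion `K[t_i : y_i ≤ x] → S`. -/
def atomHom (x : P) : MvPolynomial (BelowIx P n y x) K →ₐ[K] FaceS K P :=
  aeval fun i => tvar K P (y i.1)

/-- The inclusion of the exponents of `K[t_i : y_i ≤ x]` into those of `*E_x`. -/
def expHom (x : P) : (BelowIx P n y x →₀ ℕ) →+ EIdx P n y x :=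
  (AddMonoidHom.inl _ _).comp (Finsupp.mapRange.addMonoidHom (Nat.castAddMonoidHom ℤ))

lemma expHom_injective : Function.Injective (expHom (y := y) x) := by
  intro m m' h
  have h' := congrArg Prod.fst h
  ext i
  simpa [expHom] using DFunLike.congr_fun h' i

lemma theta_atomHom (hy : AtomEnum P n y) (q : MvPolynomial (BelowIx P n y x) K) :
    theta K P n y x (atomHom x q) = AddMonoidAlgebra.mapDomainAlgHom K K (expHom x) q := by
  revert q
  refine DFunLike.congr_fun (f := (theta K P n y x).comp (atomHom x)) ?_
  refine MvPolynomial.algHom_ext fun i => ?_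
  change theta K P n y x (aeval _ (X i)) =
    AddMonoidAlgebra.mapDomain (expHom x) (AddMonoidAlgebra.single (Finsupp.single i 1) 1)
  rw [aeval_X, theta_tvar_atom hy i.2, AddMonoidAlgebra.mapDomain_single]
  congr 1
  refine Prod.ext ?_ rfl
  ext j
  simp [expHom, dvec_apply, hy.le_iff_eq, Finsupp.single_apply, Subtype.ext_iff, eq_comm]

lemma smul_onex (s : FaceS K P) :
    s • onex K P n y x = Submodule.Quotient.mk (theta K P n y x s) := by
  rw [onex_eq_mk, ← Submodule.Quotient.mk_smul, smul_gx_def]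
  congr 1
  exact mul_one _

/-- Modulo `p_x`, every polynomial is a polynomial in the variables of the atoms below `x`. -/
lemma exists_sub_atomHom_mem_pIdeal (hP : IsSimplicialPoset P) (hy : AtomEnum P n y)
    (s : FaceS K P) :
    ∃ r ∈ (atomHom (K := K) (y := y) x).range, s - r ∈ pIdeal K P x := by
  induction s using MvPolynomial.induction_on with
  | C c => exact ⟨C c, Subalgebra.algebraMap_mem _ c, by simp⟩
  | add s s' hs hs' =>
    obtain ⟨r, hr, h⟩ := hs
    obtain ⟨r', hr', h'⟩ := hs'
    exact ⟨r + r', add_mem hr hr', by simpa only [add_sub_add_comm] using add_mem h h'⟩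
  | mul_X s z hs =>
    obtain ⟨r, hr, h⟩ := hs
    by_cases hz : z.1 ≤ x
    · refine ⟨r * ∏ i ∈ atomsBelow y z.1, tvar K P (y i),
        mul_mem hr (prod_mem fun i hi => ?_), ?_⟩
      · exact ⟨X ⟨i, (mem_atomsBelow.1 hi).trans hz⟩, by simp [atomHom]⟩
      · have hX := tvar_sub_prod_mem hP hy (le_sup_right : faceIdeal K P ≤ pIdeal K P x)
          (fun v hv => tvar_mem_pIdeal hv) z.1 hz
        rw [tvar_of_ne z.2] at hX
        convert add_mem (Ideal.mul_mem_right (X z) _ h) (Ideal.mul_mem_left _ r hX) using 1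
        ring
    · have hX := tvar_mem_pIdeal (K := K) hz
      rw [tvar_of_ne z.2] at hX
      exact ⟨0, zero_mem _, by simpa using Ideal.mul_mem_left _ s hX⟩

/-- The annihilator of `1_x` is `p_x`. -/
lemma torsionOf_onex (hP : IsSimplicialPoset P) (hy : AtomEnum P n y) :
    Ideal.torsionOf (FaceS K P) (ExMod K P n y x) (onex K P n y x) = pIdeal K P x := by
  refine le_antisymm (fun s hs => ?_) (pIdeal_le_torsionOf hP hy)
  obtain ⟨_, ⟨q, rfl⟩, hq⟩ := exists_sub_atomHom_mem_pIdeal hP hy (x := x) s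
  have h0 : atomHom x q • onex K P n y x = 0 := by
    have h := pIdeal_le_torsionOf hP hy hq
    rw [Ideal.mem_torsionOf_iff] at h hs
    simpa [sub_smul, hs] using h
  rw [smul_onex, mk_eq_zero_iff] at h0
  suffices q = 0 by simpa [this] using hq
  ext m
  have hm := h0 (expHom x m) le_rfl
  rw [theta_atomHom hy] at hm
  change (AddMonoidAlgebra.mapDomain (expHom x) q).coeff (expHom x m) = 0 at hm
  rw [AddMonoidAlgebra.coeff_mapDomain, Finsupp.mapDomain_apply expHom_injective] at hm
  exact hm

lemma mk_single_expHom_mem_span (hy : AtomEnum P n y) (m : BelowIx P n y x →₀ ℕ) :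
    (Submodule.Quotient.mk (AddMonoidAlgebra.single (expHom x m) 1) : ExMod K P n y x) ∈
      Submodule.span (FaceS K P) {onex K P n y x} := by
  refine Submodule.mem_span_singleton.2 ⟨atomHom x (monomial m 1), ?_⟩
  rw [smul_onex, theta_atomHom hy]
  congr 1
  exact AddMonoidAlgebra.mapDomain_single

lemma mk_single_mem_span (hy : AtomEnum P n y) {a : BelowIx P n y x →₀ ℤ} (ha : 0 ≤ a) :
    (Submodule.Quotient.mk (AddMonoidAlgebra.single (a, 0) 1) : ExMod K P n y x) ∈
      Submodule.span (FaceS K P) {onex K P n y x} := by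
  convert mk_single_expHom_mem_span hy (a.mapRange Int.toNat rfl) using 3
  refine Prod.ext ?_ rfl
  ext i
  simpa [expHom] using ha i

end SpanOne

section Annihilator

variable {K P n y} {x : P}

/-- `t_x` is a nonzerodivisor on `*E_x`. -/
lemma eq_zero_of_tvar_smul_eq_zero {e : ExMod K P n y x} (he : tvar K P x • e = 0) : e = 0 := by
  by_cases hx : x = ⊥
  · subst hx
    simpa using he
  obtain ⟨g, rfl⟩ := Submodule.Quotient.mk_surjective _ e
  rw [tvar_of_ne hx, ← Submodule.Quotient.mk_smul, mk_eq_zero_iff] at he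
  simp only [coeff_X_smul, le_refl, if_true] at he
  rw [mk_eq_zero_iff]
  by_cases h : ∃ i : Fin n, y i ≤ x ∧ y i = x
  · intro p hp
    have hp' := he (p + (dvec P n y x x, 0)) (by simpa using hp)
    rwa [add_sub_cancel_right, dif_pos h, add_zero] at hp'
  simp only [dif_neg h] at he
  set w : Pmx P n y x := ⟨x, hx, h⟩
  intro p hp
  by_contra hne
  let q (k : ℕ) : EIdx P n y x := p + k • (dvec P n y x x, -Finsupp.single w 1)
  have hq (k : ℕ) : (q k).2 ≤ 0 ∧ g.coeff (q k) ≠ 0 := by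
    induction k with
    | zero =>
      simp only [q, zero_smul, add_zero]
      exact ⟨hp, hne⟩
    | succ k ih =>
      have hsucc : q (k + 1) = q k + (dvec P n y x x, -Finsupp.single w 1) := by
        simp only [q, succ_nsmul, add_assoc]
      have h₁ := he (q k + (dvec P n y x x, 0)) (by simpa using ih.1)
      have h₂ : q k + (dvec P n y x x, 0) - (0, Finsupp.single w (1 : ℤ)) = q (k + 1) := by
        rw [hsucc, add_sub_assoc]
        congr 1
        ext <;> simp
      rw [add_sub_cancel_right, h₂] at h₁
      refine ⟨?_, fun h0 => ih.2 (by simpa [h0] using h₁)⟩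
      rw [hsucc, Prod.snd_add, ← sub_eq_add_neg]
      exact nonpos_sub_single ih.1 w
  have hinj : Function.Injective q := by
    intro k l hkl
    have := DFunLike.congr_fun (congrArg Prod.snd hkl) w
    simpa [q] using this
  exact Set.infinite_range_of_injective hinj (g.coeff.support.finite_toSet.subset
    (Set.range_subset_iff.2 fun k => Finsupp.mem_support_iff.2 (hq k).2))

/-- An element of nonnegative degree has a representative with monomials of nonnegative degree. -/
lemma exists_rep_nonneg {e : ExMod K P n y x}
    (he : e ∈ ⨆ aa ∈ {aa : Fin n → ℤ | ∀ i, 0 ≤ aa i}, ExGrade K P n y x aa) :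
    ∃ g : Gx K P n y x, Submodule.Quotient.mk g = e ∧
      ∀ p, g.coeff p ≠ 0 → ∀ i, 0 ≤ gdeg P n y x p i := by
  let T : Submodule K (Gx K P n y x) :=
    { carrier := {g | ∀ p, g.coeff p ≠ 0 → ∀ i, 0 ≤ gdeg P n y x p i}
      add_mem' := by
        intro g g' hg hg' p hp
        by_cases h : g.coeff p = 0
        · exact hg' p (by simpa [h] using hp)
        · exact hg p h
      zero_mem' := by simp
      smul_mem' := by
        intro c g hg p hp
        exact hg p fun h => hp (by simp [h]) }
  have hle : ⨆ aa ∈ {aa : Fin n → ℤ | ∀ i, 0 ≤ aa i}, ExGrade K P n y x aa ≤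
      T.map ((Ux K P n y x).mkQ.restrictScalars K) := by
    refine iSup₂_le fun aa haa => Submodule.span_le.2 ?_
    rintro _ ⟨p, rfl, rfl⟩
    refine ⟨AddMonoidAlgebra.single p 1, fun q hq => ?_, rfl⟩
    rw [AddMonoidAlgebra.coeff_single, Finsupp.single_apply_ne_zero] at hq
    exact hq.1 ▸ haa
  obtain ⟨g, hg, rfl⟩ := hle he
  exact ⟨g, rfl, hg⟩

lemma gdeg_of_snd_eq_zero {a : BelowIx P n y x →₀ ℤ} (i : Fin n) :
    gdeg P n y x (a, 0) i = if h : y i ≤ x then a ⟨i, h⟩ else 0 := by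
  simp [gdeg]

/-- The submodule generated by `1_x` lies in nonnegative degrees. -/
lemma mem_nonneg_of_mem_span (hy : AtomEnum P n y) {e : ExMod K P n y x}
    (he : e ∈ Submodule.span (FaceS K P) {onex K P n y x}) :
    e ∈ ⨆ aa ∈ {aa : Fin n → ℤ | ∀ i, 0 ≤ aa i}, ExGrade K P n y x aa := by
  let T : Submodule K (ExMod K P n y x) := Submodule.span K
    {e | ∃ a : BelowIx P n y x →₀ ℤ, 0 ≤ a ∧
      e = Submodule.Quotient.mk (AddMonoidAlgebra.single (a, 0) 1)}
  have hT : T ≤ ⨆ aa ∈ {aa : Fin n → ℤ | ∀ i, 0 ≤ aa i}, ExGrade K P n y x aa := by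
    refine Submodule.span_le.2 ?_
    rintro _ ⟨a, ha, rfl⟩
    refine le_iSup₂ (f := fun aa (_ : aa ∈ {aa : Fin n → ℤ | ∀ i, 0 ≤ aa i}) =>
      ExGrade K P n y x aa) (gdeg P n y x (a, 0)) (fun i => ?_) (Submodule.subset_span ⟨_, rfl, rfl⟩)
    rw [gdeg_of_snd_eq_zero]
    split_ifs with h
    · exact ha _
    · exact le_rfl
  have hX (z : Pstar P) {e : ExMod K P n y x} (he : e ∈ T) : (X z : FaceS K P) • e ∈ T := by
    induction he using Submodule.span_induction with
    | mem e he =>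
      obtain ⟨a, ha, rfl⟩ := he
      rw [← tvar_of_ne z.2, tvar_smul_mk_single hy]
      split_ifs
      · refine Submodule.subset_span ⟨_, add_nonneg ha fun i => ?_, rfl⟩
        rw [dvec_apply]
        split_ifs <;> simp
      · exact zero_mem _
    | zero => simp
    | add e e' _ _ h h' => simpa only [smul_add] using add_mem h h'
    | smul c e _ h => simpa only [smul_comm _ c] using T.smul_mem c h
  obtain ⟨s, rfl⟩ := Submodule.mem_span_singleton.1 he
  refine hT ?_
  induction s using MvPolynomial.induction_on with
  | C c =>
    rw [← MvPolynomial.algebraMap_eq, algebraMap_smul, onex_eq_mk]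
    exact T.smul_mem c (Submodule.subset_span ⟨0, le_rfl, rfl⟩)
  | add s s' hs hs' =>
    rw [add_smul]
    exact add_mem (hs (Submodule.smul_mem _ _ (Submodule.mem_span_singleton_self _)))
      (hs' (Submodule.smul_mem _ _ (Submodule.mem_span_singleton_self _)))
  | mul_X s z hs =>
    rw [mul_comm, mul_smul]
    exact hX z (hs (Submodule.smul_mem _ _ (Submodule.mem_span_singleton_self _)))

/-- If some atom below `v` is not below `x`, then `t_v` kills all elements of nonnegative degree. -/
lemma tvar_smul_eq_zero_of_nonneg {g : Gx K P n y x}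
    (hg : ∀ p, g.coeff p ≠ 0 → ∀ i, 0 ≤ gdeg P n y x p i) {v : P} {i : Fin n}
    (hiv : y i ≤ v) (hix : ¬ y i ≤ x) :
    tvar K P v • (Submodule.Quotient.mk g : ExMod K P n y x) = 0 := by
  by_cases hv : v = ⊥
  · exact absurd ((hiv.trans hv.le).trans bot_le) hix
  have hvx : ¬ v ≤ x := fun h => hix (hiv.trans h)
  have hatom : ¬ ∃ i : Fin n, y i ≤ x ∧ y i = v := fun ⟨j, hj, hjv⟩ => hvx (hjv ▸ hj)
  rw [tvar_of_ne hv, ← Submodule.Quotient.mk_smul, mk_eq_zero_iff]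
  intro p hp
  rw [coeff_X_smul, if_neg hvx, dif_neg hatom, zero_add]
  by_contra hne
  refine (hg _ hne i).not_gt ?_
  set w : Pmx P n y x := ⟨v, hv, hatom⟩
  rw [gdeg, dif_neg hix, zero_add, Prod.snd_sub]
  have hnonpos := nonpos_sub_single hp w
  have hterm (u : Pmx P n y x) :
      (p.2 - Finsupp.single w (1 : ℤ) : Pmx P n y x →₀ ℤ) u * (if y i ≤ u.1 then 1 else 0) ≤ 0 :=
    mul_nonpos_of_nonpos_of_nonneg (hnonpos u) (by split_ifs <;> simp)
  rw [Finsupp.sum_fintype _ _ (by simp)]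
  refine Finset.sum_neg' (fun u _ => hterm u) ⟨w, Finset.mem_univ _, ?_⟩
  have := hp w
  simp only [Finsupp.coe_zero, Pi.zero_apply] at this
  simp only [w, hiv, if_true, mul_one, Finsupp.coe_sub, Pi.sub_apply, Finsupp.single_eq_same]
  linarith

/-- For `z ∈ P*_{-x}` some element of `p_x` acts on `*E_x` as `1 ⊗ t_z`. -/
lemma exists_mem_pIdeal_theta_eq (hP : IsSimplicialPoset P) (hy : AtomEnum P n y)
    (w : Pmx P n y x) :
    ∃ s ∈ pIdeal K P x, theta K P n y x s =
      AddMonoidAlgebra.single ((0 : BelowIx P n y x →₀ ℤ), Finsupp.single w (1 : ℤ)) 1 := by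
  obtain ⟨z, hz, hatom⟩ := w
  by_cases hzx : z ≤ x
  · refine ⟨_, tvar_sub_prod_mem hP hy (le_sup_right : faceIdeal K P ≤ pIdeal K P x)
      (fun v hv => tvar_mem_pIdeal hv) z hzx, ?_⟩
    rw [map_sub, theta_prod_atomsBelow hy hzx, tvar_of_ne hz, theta, aeval_X, if_pos hzx,
      dif_neg hatom, add_sub_cancel_left]
  · refine ⟨_, tvar_mem_pIdeal hzx, ?_⟩
    rw [tvar_of_ne hz, theta, aeval_X, if_neg hzx, dif_neg hatom, zero_add]

/-- The elements of nonnegative degree killed by `p_x` are the multiples of `1_x`. -/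
lemma mem_span_of_pIdeal_smul_eq_zero (hP : IsSimplicialPoset P) (hy : AtomEnum P n y)
    {g : Gx K P n y x} (hg : ∀ p, g.coeff p ≠ 0 → ∀ i, 0 ≤ gdeg P n y x p i)
    (hp : ∀ s ∈ pIdeal K P x, s • (Submodule.Quotient.mk g : ExMod K P n y x) = 0) :
    (Submodule.Quotient.mk g : ExMod K P n y x) ∈
      Submodule.span (FaceS K P) {onex K P n y x} := by
  have hcoeff (p : EIdx P n y x) (hp0 : p.2 ≤ 0) (hne : p.2 ≠ 0) : g.coeff p = 0 := by
    obtain ⟨w, hw⟩ := Finsupp.ne_iff.1 hne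
    have hw1 : p.2 w + 1 ≤ 0 := (hp0 w).lt_of_ne hw
    obtain ⟨s, hs, hθ⟩ := exists_mem_pIdeal_theta_eq (K := K) hP hy w
    have h := hp s hs
    rw [← Submodule.Quotient.mk_smul, mk_eq_zero_iff] at h
    have hle : (p + (0, Finsupp.single w 1)).2 ≤ 0 := by
      intro u
      by_cases hu : u = w
      · subst hu
        simpa using hw1
      · simpa [Finsupp.single_apply, Ne.symm hu] using hp0 u
    have hcp := h _ hle
    rwa [smul_gx_def, hθ, AddMonoidAlgebra.coeff_single_mul_apply, one_mul, neg_add_eq_sub,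
      add_sub_cancel_right] at hcp
  rw [← AddMonoidAlgebra.sum_coeff_single g, Finsupp.sum, ← Submodule.mkQ_apply, map_sum]
  refine Submodule.sum_mem _ fun p hps => ?_
  have hps' := Finsupp.mem_support_iff.1 hps
  rw [← mul_one (g.coeff p), ← smul_eq_mul, ← AddMonoidAlgebra.smul_single, Submodule.mkQ_apply,
    Submodule.Quotient.mk_smul]
  refine Submodule.smul_of_tower_mem _ _ ?_
  by_cases hp0 : p.2 ≤ 0
  · have hp2 : p.2 = 0 := by_contra fun h => hps' (hcoeff p hp0 h)
    obtain ⟨a, b⟩ := p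
    obtain rfl : b = 0 := hp2
    refine mk_single_mem_span hy fun i => ?_
    simpa [gdeg_of_snd_eq_zero, i.2] using hg _ hps' i.1
  · convert zero_mem (Submodule.span (FaceS K P) {onex K P n y x})
    rw [mk_eq_zero_iff]
    intro q hq
    rw [AddMonoidAlgebra.coeff_single, Finsupp.single_apply, if_neg]
    rintro rfl
    exact hp0 hq

/-- Elements of nonnegative degree killed by `I_P` are killed by `p_x`. -/
lemma pIdeal_smul_eq_zero (hP : IsSimplicialPoset P) (hy : AtomEnum P n y)
    {g : Gx K P n y x} (hg : ∀ p, g.coeff p ≠ 0 → ∀ i, 0 ≤ gdeg P n y x p i)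
    (hI : ∀ s ∈ faceIdeal K P, s • (Submodule.Quotient.mk g : ExMod K P n y x) = 0) :
    ∀ s ∈ pIdeal K P x, s • (Submodule.Quotient.mk g : ExMod K P n y x) = 0 := by
  suffices pIdeal K P x ≤ Ideal.torsionOf (FaceS K P) (ExMod K P n y x)
    (Submodule.Quotient.mk g) from fun s hs => this hs
  refine sup_le (Ideal.span_le.2 ?_) hI
  rintro _ ⟨z, hz, rfl⟩
  change (X z : FaceS K P) • (Submodule.Quotient.mk g : ExMod K P n y x) = 0
  rw [← tvar_of_ne z.2]
  by_cases h : atomsBelow y z.1 ⊆ atomsBelow y x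
  · refine eq_zero_of_tvar_smul_eq_zero ?_
    rw [smul_smul, mul_comm]
    exact hI _ (tvar_mul_tvar_mem_faceIdeal hP hy hz h)
  · obtain ⟨i, hiz, hix⟩ := Finset.not_subset.1 h
    rw [mem_atomsBelow] at hiz hix
    exact tvar_smul_eq_zero_of_nonneg hg hiz hix

end Annihilator

/-- Proposition 2.7: `(0 :_{*E_x} I_P)_{≥0} = S_x`
(the latter identified with `S•1_x ⊆ *E_x`); consequently
`[*Hom_S(A_P, *E_x)]_{≥0} ≅ S_x = S/p_x`. -/
theorem statement6
    (hP : IsSimplicialPoset P) (hy : AtomEnum P n y) (x : P) :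
    {e : ExMod K P n y x |
        (∀ s ∈ faceIdeal K P, s • e = 0) ∧
          e ∈ ⨆ aa ∈ {aa : Fin n → ℤ | ∀ i, 0 ≤ aa i}, ExGrade K P n y x aa} =
      (Submodule.span (FaceS K P) {onex K P n y x} : Set (ExMod K P n y x)) ∧
    Nonempty ((FaceS K P ⧸ pIdeal K P x) ≃ₗ[FaceS K P]
      Submodule.span (FaceS K P) {onex K P n y x}) := by
  refine ⟨Set.ext fun e => ⟨?_, fun he => ⟨fun s hs => ?_, mem_nonneg_of_mem_span hy he⟩⟩, ?_⟩
  · rintro ⟨hI, he⟩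
    obtain ⟨g, rfl, hg⟩ := exists_rep_nonneg he
    exact mem_span_of_pIdeal_smul_eq_zero hP hy hg (pIdeal_smul_eq_zero hP hy hg hI)
  · obtain ⟨s', rfl⟩ := Submodule.mem_span_singleton.1 he
    have hone : s • onex K P n y x = 0 :=
      pIdeal_le_torsionOf hP hy ((le_sup_right : faceIdeal K P ≤ pIdeal K P x) hs)
    rw [smul_comm, hone, smul_zero]
  · rw [← torsionOf_onex hP hy]
    exact ⟨Ideal.quotTorsionOfEquivSpanSingleton _ _ _⟩

end
end

section
/- Let x, z ∈ P and let ψ : *E_x → *E_z be a nonzero clean map. Then ψ(1_x) ≠ 0. -/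
open scoped Classical
open MvPolynomial

noncomputable section

variable (K : Type) [Field K]
variable (P : Type) [Fintype P] [PartialOrder P] [OrderBot P]

variable (n : ℕ) (y : Fin n → P)

/-- The `ℤⁿ`-degree of a Laurent monomial, as an additive map. -/
def gdegHom (x : P) : EIdx P n y x →+ (Fin n → ℤ) where
  toFun := gdeg P n y x
  map_zero' := by
    funext i
    simp [gdeg]
  map_add' p q := by
    funext i
    have h := Finsupp.sum_add_index' (f := p.2) (g := q.2)
      (h := fun w c => c * (if y i ≤ w.1 then (1 : ℤ) else 0))
      (fun w => zero_mul _) (fun w c d => add_mul c d _)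
    simp only [gdeg, Prod.snd_add, Prod.fst_add, Pi.add_apply, h]
    split_ifs
    · rw [Finsupp.add_apply]
      ring
    · ring

/-- The degree `d` homogeneous component of the Laurent algebra `Gx`. -/
abbrev GxGrade (x : P) (d : Fin n → ℤ) : Submodule K (Gx K P n y x) :=
  AddMonoidAlgebra.gradeBy K (gdegHom P n y x) d

/-- The `K`-linear projection from the Laurent algebra onto `*E_x`. -/
def mkE (x : P) : Gx K P n y x →ₗ[K] ExMod K P n y x :=
  (Ux K P n y x).mkQ.restrictScalars K

lemma mkE_surjective (x : P) : Function.Surjective (mkE K P n y x) :=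
  Submodule.Quotient.mk_surjective (Ux K P n y x)

lemma smul_mkE (x : P) (s : FaceS K P) (g : Gx K P n y x) :
    s • mkE K P n y x g = mkE K P n y x (theta K P n y x s * g) :=
  rfl

lemma mkE_single_eq_zero (x : P) (p : EIdx P n y x) (hp : ∃ w, 0 < p.2 w) (c : K) :
    mkE K P n y x (AddMonoidAlgebra.single p c) = 0 := by
  have h : mkE K P n y x (AddMonoidAlgebra.single p 1) = 0 :=
    (Submodule.Quotient.mk_eq_zero _).2 (Submodule.subset_span ⟨p, hp, rfl⟩)
  rw [← mul_one c, ← AddMonoidAlgebra.smul_single', map_smul, h, smul_zero]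

lemma exists_mIdx_eq (x : P) (p : EIdx P n y x) (hp : ∀ w, p.2 w ≤ 0) :
    ∃ b, p = mIdx P n y x p.1 b := by
  refine ⟨p.2.mapRange (fun c => (-c).toNat) (by simp), Prod.ext rfl ?_⟩
  ext w
  have := hp w
  simp [mIdx, this]

lemma mem_ExGrade_iff (x : P) (d : Fin n → ℤ) (e : ExMod K P n y x) :
    e ∈ ExGrade K P n y x d ↔ ∃ g ∈ GxGrade K P n y x d, mkE K P n y x g = e := by
  have h : ExGrade K P n y x d = (GxGrade K P n y x d).map (mkE K P n y x) := by
    apply le_antisymm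
    · refine Submodule.span_le.2 ?_
      rintro _ ⟨p, rfl, rfl⟩
      exact ⟨_, AddMonoidAlgebra.single_mem_gradeBy (gdegHom P n y x) p (1 : K), rfl⟩
    · rintro _ ⟨g, hg, rfl⟩
      rw [← AddMonoidAlgebra.sum_coeff_single g, Finsupp.sum, map_sum]
      refine Submodule.sum_mem _ fun p hp => ?_
      rw [← mul_one (g.coeff p), ← AddMonoidAlgebra.smul_single', map_smul]
      exact Submodule.smul_mem _ _ (Submodule.subset_span
        ⟨p, (AddMonoidAlgebra.mem_gradeBy_iff ..).1 hg (Finset.mem_coe.2 hp), rfl⟩)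
  rw [h, Submodule.mem_map]

lemma coeff_theta_mul_eq_zero (x : P) (s : FaceS K P) (g : Gx K P n y x)
    (hg : ∀ p : EIdx P n y x, (∀ w, p.2 w ≤ 0) → g.coeff p = 0)
    (p : EIdx P n y x) (hp : ∀ w, p.2 w ≤ 0) :
    (theta K P n y x s * g).coeff p = 0 := by
  induction s using MvPolynomial.induction_on generalizing g p with
  | C c =>
    rw [← MvPolynomial.algebraMap_eq, AlgHom.commutes, ← Algebra.smul_def,
      AddMonoidAlgebra.coeff_smul_apply, hg p hp, smul_zero]
  | add s t hs ht =>
    rw [map_add, add_mul, AddMonoidAlgebra.coeff_add, Finsupp.add_apply, hs g hg p hp,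
      ht g hg p hp, add_zero]
  | mul_X s u hs =>
    rw [map_mul, mul_assoc]
    refine hs _ (fun q hq => ?_) p hp
    rw [theta, aeval_X, add_mul, AddMonoidAlgebra.coeff_add, Finsupp.add_apply]
    have h₁ : ∀ a : BelowIx P n y x →₀ ℤ,
        (AddMonoidAlgebra.single (a, (0 : Pmx P n y x →₀ ℤ)) (1 : K) * g).coeff q = 0 := by
      intro a
      rw [AddMonoidAlgebra.coeff_single_mul_apply, hg _ (by simpa using hq), mul_zero]
    have h₂ : ∀ w : Pmx P n y x, (AddMonoidAlgebra.single
        ((0 : BelowIx P n y x →₀ ℤ), Finsupp.single w (1 : ℤ)) (1 : K) * g).coeff q = 0 := by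
      intro w
      rw [AddMonoidAlgebra.coeff_single_mul_apply, hg, mul_zero]
      intro v
      have h0 : 0 ≤ Finsupp.single w (1 : ℤ) v := by
        rw [Finsupp.single_apply]; split_ifs <;> simp
      have := hq v
      simp only [Prod.snd_add, Prod.snd_neg, Finsupp.add_apply, Finsupp.neg_apply]
      linarith
    split_ifs <;> simp only [h₁, h₂, zero_mul, AddMonoidAlgebra.coeff_zero, Finsupp.zero_apply,
      add_zero]

lemma coeff_eq_zero_of_mem_Ux (x : P) (g : Gx K P n y x) (hg : g ∈ Ux K P n y x)
    (p : EIdx P n y x) (hp : ∀ w, p.2 w ≤ 0) : g.coeff p = 0 := by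
  induction hg using Submodule.span_induction generalizing p with
  | mem g hg =>
    obtain ⟨q, ⟨w, hw⟩, rfl⟩ := hg
    rw [AddMonoidAlgebra.coeff_single, Finsupp.single_apply, if_neg]
    rintro rfl
    exact absurd (hp w) (not_le.2 hw)
  | zero => rfl
  | add g g' _ _ hg hg' =>
    rw [AddMonoidAlgebra.coeff_add, Finsupp.add_apply, hg p hp, hg' p hp, add_zero]
  | smul s g _ hg => exact coeff_theta_mul_eq_zero K P n y x s g hg p hp

/-- The monomial coefficients of an element of `*E_x` do not depend on the representative. -/
lemma coeff_eq_of_mkE_eq (x : P) {g g' : Gx K P n y x}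
    (h : mkE K P n y x g = mkE K P n y x g') (p : EIdx P n y x) (hp : ∀ w, p.2 w ≤ 0) :
    g.coeff p = g'.coeff p := by
  have := coeff_eq_zero_of_mem_Ux K P n y x _ ((Submodule.Quotient.eq _).1 h) p hp
  rw [AddMonoidAlgebra.coeff_sub, Finsupp.sub_apply] at this
  exact sub_eq_zero.1 this

lemma exists_coeff_ne_zero (x : P) (g : Gx K P n y x) (hg : mkE K P n y x g ≠ 0) :
    ∃ p : EIdx P n y x, (∀ w, p.2 w ≤ 0) ∧ g.coeff p ≠ 0 := by
  contrapose! hg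
  rw [← AddMonoidAlgebra.sum_coeff_single g, Finsupp.sum, map_sum]
  refine Finset.sum_eq_zero fun p hp => mkE_single_eq_zero K P n y x p ?_ _
  by_contra! h
  exact Finsupp.mem_support_iff.1 hp (hg p h)

lemma coeff_eq_zero_of_mem_cleanL (x : P) (g : Gx K P n y x)
    (hg : mkE K P n y x g ∈ cleanL K P n y x) (a : BelowIx P n y x →₀ ℤ) :
    g.coeff (a, 0) = 0 := by
  suffices h : ∀ e ∈ cleanL K P n y x, ∀ g, mkE K P n y x g = e → g.coeff (a, 0) = 0 from
    h _ hg g rfl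
  intro e he
  induction he using Submodule.span_induction with
  | mem e he =>
    obtain ⟨a', b, hb, -, rfl⟩ := he
    intro g hg
    rw [coeff_eq_of_mkE_eq K P n y x hg _ (fun w => le_rfl), AddMonoidAlgebra.coeff_single,
      Finsupp.single_apply, if_neg]
    intro h
    apply hb
    ext w
    simpa [mIdx] using DFunLike.congr_fun (congrArg Prod.snd h) w
  | zero =>
    intro g hg
    exact coeff_eq_of_mkE_eq K P n y x (g' := 0) (by rw [hg, map_zero]) _ (fun w => le_rfl)
  | add e e' _ _ h h' =>
    intro g hg
    obtain ⟨u, rfl⟩ := mkE_surjective K P n y x e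
    obtain ⟨v, rfl⟩ := mkE_surjective K P n y x e'
    rw [coeff_eq_of_mkE_eq K P n y x (g' := u + v) (by rw [hg, map_add]) _ (fun w => le_rfl),
      AddMonoidAlgebra.coeff_add, Finsupp.add_apply, h u rfl, h' v rfl, add_zero]
  | smul c e _ h =>
    intro g hg
    obtain ⟨u, rfl⟩ := mkE_surjective K P n y x e
    rw [coeff_eq_of_mkE_eq K P n y x (g' := c • u) (by rw [hg, map_smul]) _ (fun w => le_rfl),
      AddMonoidAlgebra.coeff_smul_apply, h u rfl, smul_zero]

variable {P n y} in
lemma AtomEnum.le_iff (hy : AtomEnum P n y) (i j : Fin n) : y i ≤ y j ↔ i = j := by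
  refine ⟨fun h => hy.1 ?_, fun h => h ▸ le_rfl⟩
  exact (((hy.2 _).2 ⟨j, rfl⟩).le_iff.1 h).resolve_left ((hy.2 _).2 ⟨i, rfl⟩).1

variable {P n y} in
lemma AtomEnum.ne_bot (hy : AtomEnum P n y) (i : Fin n) : y i ≠ ⊥ :=
  ((hy.2 _).2 ⟨i, rfl⟩).1

lemma theta_X_mem_GxGrade (x : P) (u : Pstar P) :
    theta K P n y x (X u) ∈ GxGrade K P n y x (tdeg P n y u) := by
  rw [theta, aeval_X]
  refine Submodule.add_mem _ ?_ ?_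
  · split_ifs with hu
    · convert AddMonoidAlgebra.single_mem_gradeBy (gdegHom P n y x) (dvec P n y x u.1, 0) (1 : K)
      funext i
      simp only [tdeg, gdegHom, gdeg, dvec, AddMonoidHom.coe_mk, ZeroHom.coe_mk,
        Finsupp.sum_zero_index, add_zero, Finsupp.equivFunOnFinite_symm_apply_apply]
      by_cases h : y i ≤ u.1
      · simp [h, h.trans hu]
      · simp [h]
    · exact Submodule.zero_mem _
  · split_ifs with hu
    · exact Submodule.zero_mem _
    · convert AddMonoidAlgebra.single_mem_gradeBy (gdegHom P n y x)
        (0, Finsupp.single (⟨u.1, u.2, hu⟩ : Pmx P n y x) (1 : ℤ)) (1 : K)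
      funext i
      simp [tdeg, gdegHom, gdeg]

/-- The exponents of Laurent monomials of `*E_z` acting on it as homogeneous elements of `S`. -/
def liftableExponents (z : P) : AddSubmonoid (EIdx P n y z) where
  carrier := {p | ∃ s δ, theta K P n y z s = AddMonoidAlgebra.single p 1 ∧
    ∀ x, theta K P n y x s ∈ GxGrade K P n y x δ}
  zero_mem' := ⟨1, 0, map_one _, fun x => by
    rw [map_one]; exact SetLike.GradedOne.one_mem⟩
  add_mem' := by
    rintro p q ⟨s, δ, hs, hδ⟩ ⟨t, ε, ht, hε⟩
    refine ⟨s * t, δ + ε, ?_, fun x => ?_⟩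
    · rw [map_mul, hs, ht, AddMonoidAlgebra.single_mul_single, mul_one]
    · rw [map_mul]
      exact SetLike.GradedMul.mul_mem (hδ x) (hε x)

lemma theta_X_atom (hy : AtomEnum P n y) (z : P) (i : BelowIx P n y z) :
    theta K P n y z (X ⟨y i.1, hy.ne_bot i.1⟩) =
      AddMonoidAlgebra.single (Finsupp.single i 1, 0) 1 := by
  rw [theta, aeval_X, if_pos i.2, dif_pos ⟨i.1, i.2, rfl⟩, add_zero]
  congr 2
  ext j
  simp [dvec, hy.le_iff, Finsupp.single_apply, Subtype.ext_iff, eq_comm]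

lemma single_atom_mem_liftableExponents (hy : AtomEnum P n y) (z : P) (i : BelowIx P n y z) :
    (Finsupp.single i 1, 0) ∈ liftableExponents K P n y z :=
  ⟨_, _, theta_X_atom K P n y hy z i, fun x => theta_X_mem_GxGrade K P n y x _⟩

lemma single_mem_liftableExponents (hy : AtomEnum P n y) (z : P) (w : Pmx P n y z) :
    (0, Finsupp.single w 1) ∈ liftableExponents K P n y z := by
  by_cases hw : w.1 ≤ z
  · refine ⟨X ⟨w.1, w.2.1⟩ - ∏ i : BelowIx P n y z with y i.1 ≤ w.1, X ⟨y i.1, hy.ne_bot i.1⟩,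
      tdeg P n y ⟨w.1, w.2.1⟩, ?_, fun x => ?_⟩
    · rw [map_sub, map_prod, Finset.prod_congr rfl fun i _ => theta_X_atom K P n y hy z i,
        AddMonoidAlgebra.prod_single, theta, aeval_X, if_pos hw, dif_neg w.2.2,
        Finset.prod_const_one, sub_eq_iff_eq_add, add_comm]
      congr 2
      refine Prod.ext ?_ ?_
      · ext j
        simp [Prod.fst_sum, dvec, Finsupp.finsetSum_apply, Finsupp.single_apply]
      · simp [Prod.snd_sum]
    · rw [map_sub]
      refine Submodule.sub_mem _ (theta_X_mem_GxGrade K P n y x _) ?_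
      have h : tdeg P n y ⟨w.1, w.2.1⟩ = ∑ i : BelowIx P n y z with y i.1 ≤ w.1,
          tdeg P n y ⟨y i.1, hy.ne_bot i.1⟩ := by
        funext j
        simp only [tdeg, Finset.sum_apply, hy.le_iff, Finset.sum_filter]
        split_ifs with hj
        · rw [Finset.sum_eq_single ⟨j, hj.trans hw⟩]
          · simp [hj]
          · intro i _ hi
            have : j ≠ i.1 := fun h => hi (Subtype.ext h.symm)
            simp [this]
          · simp
        · refine (Finset.sum_eq_zero fun i _ => ?_).symm
          split_ifs with h₁ h₂
          · exact absurd (h₂ ▸ h₁) hj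
          all_goals rfl
      rw [h, map_prod]
      exact SetLike.prod_mem_graded _ _ _ fun i _ => theta_X_mem_GxGrade K P n y x _
  · refine ⟨X ⟨w.1, w.2.1⟩, _, ?_, fun x => theta_X_mem_GxGrade K P n y x _⟩
    rw [theta, aeval_X, if_neg hw, dif_neg w.2.2, zero_add]

lemma mem_liftableExponents (hy : AtomEnum P n y) (z : P) (p : EIdx P n y z)
    (h₁ : ∀ i, 0 ≤ p.1 i) (h₂ : ∀ w, 0 ≤ p.2 w) : p ∈ liftableExponents K P n y z := by
  have h : p = ∑ i, (p.1 i).toNat • ((Finsupp.single i 1, 0) : EIdx P n y z) +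
      ∑ w, (p.2 w).toNat • ((0, Finsupp.single w 1) : EIdx P n y z) := by
    refine Prod.ext ?_ ?_
    · ext j
      simp [Prod.fst_sum, h₁]
    · ext j
      simp [Prod.snd_sum, h₂]
  rw [h]
  exact add_mem
    (sum_mem fun i _ => nsmul_mem (single_atom_mem_liftableExponents K P n y hy z i) _)
    (sum_mem fun w _ => nsmul_mem (single_mem_liftableExponents K P n y hy z w) _)

/-- A homomorphism killing `1_x` maps monomials of nonnegative degree into `L(*E_z)` as soon as
it maps `L(*E_x)` into `L(*E_z)`. -/
lemma map_mkE_single_mem_cleanL (hy : AtomEnum P n y) (x z : P)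
    (ψ : ExMod K P n y x →ₗ[FaceS K P] ExMod K P n y z)
    (hψ : ∀ e ∈ cleanL K P n y x, ψ e ∈ cleanL K P n y z) (hone : ψ (onex K P n y x) = 0)
    (p : EIdx P n y x) (hp : ∀ i, 0 ≤ gdeg P n y x p i) :
    ψ (mkE K P n y x (AddMonoidAlgebra.single p 1)) ∈ cleanL K P n y z := by
  by_cases hpos : ∃ w, 0 < p.2 w
  · rw [mkE_single_eq_zero K P n y x p hpos, map_zero]
    exact Submodule.zero_mem _
  push Not at hpos
  obtain ⟨b, hb⟩ := exists_mIdx_eq P n y x p hpos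
  by_cases hb0 : b = 0
  · have h2 : p.2 = 0 := by
      rw [hb, hb0]
      simp [mIdx]
    have h1 : ∀ i, 0 ≤ p.1 i := fun i => by simpa [gdeg, h2, i.2] using hp i.1
    obtain ⟨s, -, hs, -⟩ := mem_liftableExponents K P n y hy x p h1 (by simp [h2])
    have : mkE K P n y x (AddMonoidAlgebra.single p 1) = s • onex K P n y x := by
      have h0 : onex K P n y x = mkE K P n y x 1 := by
        have : mIdx P n y x 0 0 = 0 := by simp [mIdx]
        rw [onex, emono, this]
        rfl
      rw [h0, smul_mkE, hs, mul_one]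
    rw [this, map_smul, hone, smul_zero]
    exact Submodule.zero_mem _
  · rw [hb] at hp ⊢
    exact hψ _ (Submodule.subset_span ⟨_, b, hb0, hp, rfl⟩)

/-- Lemma 3.4: a nonzero clean map `ψ : *E_x → *E_z`
satisfies `ψ(1_x) ≠ 0`. -/
theorem statement9
    (hP : IsSimplicialPoset P) (hy : AtomEnum P n y) (x z : P)
    (ψ : ExMod K P n y x →ₗ[FaceS K P] ExMod K P n y z)
    (hclean : IsClean K P n y x z ψ) (hne : ψ ≠ 0) :
    ψ (onex K P n y x) ≠ 0 := by
  intro hone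
  apply hne
  obtain ⟨hdeg, hL⟩ := hclean
  have hK : ∀ (c : K) e, ψ (c • e) = c • ψ e := fun c e => by
    rw [← algebraMap_smul (FaceS K P) c e, map_smul, algebraMap_smul]
  suffices h : ∀ p, ψ (mkE K P n y x (AddMonoidAlgebra.single p 1)) = 0 by
    refine LinearMap.ext fun e => ?_
    obtain ⟨g, rfl⟩ := mkE_surjective K P n y x e
    rw [← AddMonoidAlgebra.sum_coeff_single g, Finsupp.sum, map_sum, map_sum]
    refine Finset.sum_eq_zero fun p _ => ?_
    rw [← mul_one (g.coeff p), ← AddMonoidAlgebra.smul_single', map_smul, hK, h, smul_zero]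
  intro p
  by_contra hp
  obtain ⟨f, hf⟩ := mkE_surjective K P n y z (ψ (mkE K P n y x (AddMonoidAlgebra.single p 1)))
  obtain ⟨q, hq, hfq⟩ := exists_coeff_ne_zero K P n y z f (hf ▸ hp)
  obtain ⟨s, δ, hs, hδ⟩ := mem_liftableExponents K P n y hy z
    (q.1.mapRange (fun c => ((-c).toNat : ℤ)) (by simp), -q.2) (by simp) (by simpa using hq)
  set c := q.1.mapRange (fun c => ((-c).toNat : ℤ)) (by simp)
  set g := theta K P n y x s * AddMonoidAlgebra.single p 1
  have hg : g ∈ GxGrade K P n y x (δ + gdeg P n y x p) :=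
    SetLike.GradedMul.mul_mem (hδ x) (AddMonoidAlgebra.single_mem_gradeBy (gdegHom P n y x) p (1 : K))
  have hsf : mkE K P n y z (theta K P n y z s * f) = ψ (mkE K P n y x g) := by
    rw [← smul_mkE, ← smul_mkE, map_smul, hf]
  have hcoeff : (theta K P n y z s * f).coeff (c + q.1, 0) ≠ 0 := by
    rw [hs, AddMonoidAlgebra.coeff_single_mul_apply, one_mul]
    convert hfq using 2
    simp
  have hnonneg : ∀ i, 0 ≤ (δ + gdeg P n y x p) i := by
    obtain ⟨f', hf', hf'g⟩ := (mem_ExGrade_iff K P n y z _ _).1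
      (hdeg _ _ ((mem_ExGrade_iff K P n y x _ _).2 ⟨g, hg, rfl⟩))
    rw [coeff_eq_of_mkE_eq K P n y z (hsf.trans hf'g.symm) _ (fun w => le_rfl)] at hcoeff
    have h : gdeg P n y z (c + q.1, 0) = _ := (AddMonoidAlgebra.mem_gradeBy_iff ..).1 hf' (Finsupp.mem_support_iff.2 hcoeff)
    intro i
    rw [← h]
    simp only [gdeg, Finsupp.sum_zero_index, add_zero]
    split_ifs with hi
    · simp only [c, Finsupp.add_apply, Finsupp.mapRange_apply]
      omega
    · exact le_rfl
  refine hcoeff (coeff_eq_zero_of_mem_cleanL K P n y z _ ?_ _)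
  rw [hsf, ← AddMonoidAlgebra.sum_coeff_single g, Finsupp.sum, map_sum, map_sum]
  refine Submodule.sum_mem _ fun r hr => ?_
  rw [← mul_one (g.coeff r), ← AddMonoidAlgebra.smul_single', map_smul, hK]
  refine Submodule.smul_mem _ _ (map_mkE_single_mem_cleanL K P n y hy x z ψ hL hone r ?_)
  have h : gdeg P n y x r = _ :=
    (AddMonoidAlgebra.mem_gradeBy_iff ..).1 hg (Finset.mem_coe.2 hr)
  rwa [h]

end
end

section
/- For every rank-1 element y_i of P, every degree-preserving S-homomorphism φ : *E_{y_i} → *E_{0̂} is clean. -/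
open scoped Classical
open MvPolynomial

noncomputable section

variable (K : Type) [Field K]
variable (P : Type) [Fintype P] [PartialOrder P] [OrderBot P]

variable (n : ℕ) (y : Fin n → P)

variable {P} in
/-- In a simplicial poset, every element other than `⊥` and the atom `x` lies above an atom
different from `x`. -/
theorem IsSimplicialPoset.exists_isAtom_le_ne (hP : IsSimplicialPoset P) {x w : P}
    (hx : IsAtom x) (hw : w ≠ ⊥) (hwx : w ≠ x) : ∃ p, IsAtom p ∧ p ≤ w ∧ p ≠ x := by
  by_cases hxw : x ≤ w
  · obtain ⟨m, ⟨e⟩⟩ := hP w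
    have hlt : e ⟨x, hxw⟩ < e ⊤ :=
      e.lt_iff_lt.2 (lt_of_le_of_ne hxw fun h => hwx (congrArg Subtype.val h.symm))
    obtain ⟨k, -, hk⟩ := Finset.exists_of_ssubset hlt
    have hbot : (e.symm {k} : P) ≠ ⊥ := by
      intro h
      have h' : e.symm {k} = ⊥ := Subtype.ext h
      rw [e.symm_apply_eq, map_bot] at h'
      exact Finset.singleton_ne_empty k h'
    obtain ⟨p, hp, hpk⟩ := (eq_bot_or_exists_atom_le (e.symm {k} : P)).resolve_left hbot
    refine ⟨p, hp, hpk.trans (e.symm {k}).2, ?_⟩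
    rintro rfl
    have hle : e ⟨p, hxw⟩ ≤ {k} := (e.le_symm_apply).1 hpk
    have hemp : e ⟨p, hxw⟩ = ⊥ := by
      rcases Finset.subset_singleton_iff.1 hle with h | h
      · exact h
      · exact absurd (h ▸ Finset.mem_singleton_self k) hk
    rw [map_eq_bot_iff] at hemp
    exact hx.1 (congrArg Subtype.val hemp)
  · obtain ⟨p, hp, hpw⟩ := (eq_bot_or_exists_atom_le w).resolve_left hw
    exact ⟨p, hp, hpw, fun h => hxw (h ▸ hpw)⟩

variable {P n y} in
/-- A monomial of `*E_x` has negative degree at every atom `y_j ≰ x` lying below an element that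
occurs in its second factor. -/
theorem gdeg_mIdx_neg {x : P} (a : BelowIx P n y x →₀ ℤ) (b : Pmx P n y x →₀ ℕ)
    {w : Pmx P n y x} (hw : b w ≠ 0) {j : Fin n} (hjx : ¬ y j ≤ x) (hjw : y j ≤ w.1) :
    gdeg P n y x (mIdx P n y x a b) j < 0 := by
  simp only [gdeg, dif_neg hjx, zero_add, Finsupp.sum]
  refine Finset.sum_neg' (fun v _ => ?_) ⟨w, ?_, ?_⟩
  · simp only [mIdx, Finsupp.neg_apply, Finsupp.mapRange_apply]
    split_ifs <;> simp
  · simpa [mIdx] using hw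
  · simpa [mIdx, hjw] using Nat.pos_of_ne_zero hw

variable {P n y} in
/-- `L(*E_{y_i})` vanishes. -/
theorem cleanL_atom (hP : IsSimplicialPoset P) (hy : AtomEnum P n y) (i : Fin n) :
    cleanL K P n y (y i) = ⊥ := by
  rw [cleanL, Submodule.span_eq_bot]
  rintro _ ⟨a, b, hb, hdeg, -⟩
  obtain ⟨w, hw⟩ := Finsupp.ne_iff.1 hb
  have hi : IsAtom (y i) := (hy.2 _).2 ⟨i, rfl⟩
  obtain ⟨p, hp, hpw, hpi⟩ := hP.exists_isAtom_le_ne hi w.2.1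
    fun h => w.2.2 ⟨i, le_rfl, h.symm⟩
  obtain ⟨j, rfl⟩ := (hy.2 p).1 hp
  exact absurd (hdeg j) (gdeg_mIdx_neg a b hw (fun h => hpi ((hi.le_iff_eq hp.1).1 h)) hpw).not_ge

/-- Remark 3.6: every degree preserving `S`-homomorphism
`*E_{y_i} → *E_{0̂}` is clean. -/
theorem statement11
    (hP : IsSimplicialPoset P) (hy : AtomEnum P n y) (i : Fin n)
    (φ : ExMod K P n y (y i) →ₗ[FaceS K P] ExMod K P n y (⊥ : P))
    (hφ : DegZero K P n y (y i) (⊥ : P) φ) :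
    IsClean K P n y (y i) (⊥ : P) φ := by
  refine ⟨hφ, fun e he => ?_⟩
  rw [cleanL_atom K hP hy i, Submodule.mem_bot] at he
  rw [he, map_zero]
  exact Submodule.zero_mem _

end
end
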